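/- Let σ take only dyadic values: σ(s) = Σ_{m≥0} 2^{-m} 1_{I_m}(s) where I_m = {t ∈ T : σ(t) = 2^{-m}} partition T, and let W : ℓ_1(T) → ℓ_q(T) be the bounded operator determined by W(δ_t) = 2^{-m} Σ_{r⪯t, r∈I_m} α(r) δ_r for t ∈ I_m. Then for the set D_W := {W(δ_t) : t ∈ T} ⊆ ℓ_q(T) and every ε > 0, the covering numbers satisfy N(D_W, ‖·‖_q, ε) ≤ Ñ(T,d,ε) + 1, i.e., if T has an order ε-net of cardinality n then D_W can be covered by n + 1 open ε-balls of ℓ_q(T). -/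

import Mathlib

open scoped ENNReal NNReal
open MeasureTheory

noncomputable section

/-- A rooted tree structure on a partially ordered type with bottom element (the root):
the set of ancestors of any node is finite and totally ordered, and every node has
finitely many offspring (covering elements). -/
def IsTree (T : Type) [PartialOrder T] [OrderBot T] : Prop :=
  (∀ s : T, (Set.Iic s).Finite) ∧
  (∀ s a b : T, a ≤ s → b ≤ s → a ≤ b ∨ b ≤ a) ∧
  (∀ t : T, {s : T | t ⋖ s}.Finite)

/-- The binary tree: a rooted tree in which every node has exactly two offspring. -/
def IsBinaryTree (T : Type) [PartialOrder T] [OrderBot T] : Prop :=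
  IsTree T ∧ ∀ t : T, Nat.card {s : T | t ⋖ s} = 2

/-- `glb` assigns to any two nodes their greatest common ancestor. -/
def IsGCA {T : Type} [PartialOrder T] (glb : T → T → T) : Prop :=
  ∀ t s : T, glb t s ≤ t ∧ glb t s ≤ s ∧ ∀ u : T, u ≤ t → u ≤ s → u ≤ glb t s

/-- The generation `|t|` of a node: the number of its strict ancestors. -/
def gen {T : Type} [PartialOrder T] (t : T) : ℕ := Nat.card (Set.Iio t)

/-- The distance `max_{t ≺ v ⪯ s} (∑_{t ≺ r ⪯ v} α(r)^q)^{1/q} σ(v)` along a branch. -/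
def dOrd {T : Type} [PartialOrder T] (q : ℝ) (α σ : T → ℝ) (t s : T) : ℝ :=
  sSup ((fun v => (∑ᶠ r ∈ Set.Ioc t v, α r ^ q) ^ (1 / q) * σ v) '' Set.Ioc t s)

/- The tree metric `d`, extended by symmetry and via greatest common ancestors. -/
open Classical in
def treeDist {T : Type} [PartialOrder T] (q : ℝ) (α σ : T → ℝ)
    (glb : T → T → T) (t s : T) : ℝ :=
  if t ≤ s then dOrd q α σ t s
  else if s ≤ t then dOrd q α σ s t
  else dOrd q α σ (glb t s) t + dOrd q α σ (glb t s) s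

/-- `N(T,d,ε)`: minimal number of open `ε`-balls needed to cover `T` (`∞` if none). -/
def coveringNumber {T : Type} (d : T → T → ℝ) (ε : ℝ) : ℝ≥0∞ :=
  ⨅ S ∈ {S : Finset T | ∀ t : T, ∃ s ∈ S, d s t < ε}, (S.card : ℝ≥0∞)

/-- `Ñ(T,d,ε)`: minimal cardinality of an order `ε`-net of `T`. -/
def orderCoveringNumber {T : Type} [PartialOrder T] (d : T → T → ℝ) (ε : ℝ) : ℝ≥0∞ :=
  ⨅ S ∈ {S : Finset T | ∀ t : T, ∃ s ∈ S, s ≤ t ∧ d s t < ε}, (S.card : ℝ≥0∞)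

/-- Minimal number of open `ε`-balls of a normed space needed to cover the set `A`. -/
def setCoveringNumber {Y : Type} [NormedAddCommGroup Y] (A : Set Y) (ε : ℝ) : ℝ≥0∞ :=
  ⨅ F ∈ {F : Finset Y | ∀ a ∈ A, ∃ y ∈ F, ‖a - y‖ < ε}, (F.card : ℝ≥0∞)

/-- The dyadic entropy numbers `e_n(V)` of an operator `V`. -/
def entropyNumber {X Y : Type} [NormedAddCommGroup X] [NormedSpace ℝ X]
    [NormedAddCommGroup Y] [NormedSpace ℝ Y] (n : ℕ) (V : X →L[ℝ] Y) : ℝ :=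
  sInf {ε : ℝ | 0 < ε ∧ ∃ F : Finset Y, F.card ≤ 2 ^ (n - 1) ∧
    ∀ x : X, ‖x‖ ≤ 1 → ∃ y ∈ F, ‖V x - y‖ < ε}

/-- The space `ℓ₁(T)`. -/
abbrev ellOne (T : Type) := lp (fun _ : T => ℝ) 1

/-- The space `ℓ_q(T)`. -/
abbrev ellQ (T : Type) (q : ℝ) := lp (fun _ : T => ℝ) (ENNReal.ofReal q)

/-- A vector of `ℓ_q` which vanishes off the finite set `A` and is dominated on `A` by `c * α`
has norm at most `c` times the `ℓ_q`-norm of the restriction of `α` to `A`. -/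
theorem ellQ_norm_le_of_support {T : Type} {q : ℝ} (hq : 0 < q) {A : Set T} (hA : A.Finite)
    {α : T → ℝ} (hα : ∀ t, 0 ≤ α t) {c : ℝ} (hc : 0 ≤ c) (x : ellQ T q)
    (hx : ∀ r ∈ A, |x r| ≤ c * α r) (hx0 : ∀ r ∉ A, x r = 0) :
    ‖x‖ ≤ (∑ᶠ r ∈ A, α r ^ q) ^ (1 / q) * c := by
  have hq' : (ENNReal.ofReal q).toReal = q := ENNReal.toReal_ofReal hq.le
  have hsum : ∑' r, ‖x r‖ ^ q = ∑ r ∈ hA.toFinset, ‖x r‖ ^ q :=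
    tsum_eq_sum fun r hr => by
      rw [hx0 r (by simpa using hr), norm_zero, Real.zero_rpow hq.ne']
  rw [lp.norm_eq_tsum_rpow (by rwa [hq']), hq', hsum, finsum_mem_eq_finite_toFinset_sum _ hA]
  have hS : 0 ≤ ∑ r ∈ hA.toFinset, α r ^ q :=
    Finset.sum_nonneg fun r _ => Real.rpow_nonneg (hα r) q
  have hle : ∑ r ∈ hA.toFinset, ‖x r‖ ^ q ≤ (∑ r ∈ hA.toFinset, α r ^ q) * c ^ q := by
    rw [Finset.sum_mul]
    refine Finset.sum_le_sum fun r hr => ?_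
    rw [← Real.mul_rpow (hα r) hc, mul_comm]
    exact Real.rpow_le_rpow (norm_nonneg _) (hx r (by simpa using hr)) hq.le
  calc _ ≤ ((∑ r ∈ hA.toFinset, α r ^ q) * c ^ q) ^ (1 / q) :=
        Real.rpow_le_rpow (Finset.sum_nonneg fun r _ => by positivity) hle (by positivity)
    _ = _ := by
        rw [Real.mul_rpow hS (by positivity), ← Real.rpow_mul hc, mul_one_div_cancel hq.ne',
          Real.rpow_one]

/-- The term of the maximum defining `dOrd` at the upper end point is a lower bound. -/
theorem le_dOrd {T : Type} [PartialOrder T] {q : ℝ} {α σ : T → ℝ} {s t : T}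
    (hfin : (Set.Iic t).Finite) (hst : s < t) :
    (∑ᶠ r ∈ Set.Ioc s t, α r ^ q) ^ (1 / q) * σ t ≤ dOrd q α σ s t :=
  le_csSup ((hfin.subset Set.Ioc_subset_Iic_self).image _).bddAbove
    (Set.mem_image_of_mem _ ⟨hst, le_rfl⟩)

open Classical in
theorem stmt3 {T : Type} [Countable T] [PartialOrder T] [OrderBot T]
    (htree : IsTree T) (q : ℝ) (hq : 1 < q)
    (α σ : T → ℝ) (hα : ∀ t, 0 < α t) (hσpos : ∀ t, 0 < σ t)
    (hσmono : ∀ ⦃t s : T⦄, t ≤ s → σ s ≤ σ t)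
    (K : ℝ) (hK : ∀ s : T, (∑ᶠ r ∈ Set.Iic s, α r ^ q) ^ (1 / q) * σ s ≤ K)
    (glb : T → T → T) (hglb : IsGCA glb)
    [DecidableEq T]
    (hroot : σ (⊥ : T) = 1)
    (hdyad : ∀ t : T, ∃ m : ℕ, σ t = (2 : ℝ) ^ (-(m : ℤ)))
    [Fact (1 ≤ ENNReal.ofReal q)]
    (W : ellOne T →L[ℝ] ellQ T q)
    (hW : ∀ t r : T, (W (lp.single 1 t 1) : ∀ _ : T, ℝ) r =
      if r ≤ t ∧ σ r = σ t then σ t * α r else 0) :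
    ∀ ε : ℝ, 0 < ε →
      setCoveringNumber {y : ellQ T q | ∃ t : T, y = W (lp.single 1 t 1)} ε ≤
        orderCoveringNumber (treeDist q α σ glb) ε + 1 := by
  intro ε hε
  have key : ∀ (t s : T) (x : ellQ T q), s < t → treeDist q α σ glb s t < ε →
      (∀ r ∈ Set.Ioc s t, |x r| ≤ σ t * α r) → (∀ r ∉ Set.Ioc s t, x r = 0) → ‖x‖ < ε := by
    intro t s x hst hd hx hx0
    rw [treeDist, if_pos hst.le] at hd
    exact ((ellQ_norm_le_of_support (zero_lt_one.trans hq)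
      ((htree.1 t).subset Set.Ioc_subset_Iic_self) (fun r => (hα r).le) (hσpos t).le x hx
      hx0).trans (le_dOrd (htree.1 t) hst)).trans_lt hd
  unfold orderCoveringNumber
  simp only [ENNReal.iInf_add]
  refine le_iInf₂ fun S hS => ?_
  let F : Finset (ellQ T q) := insert 0 (S.image fun s => W (lp.single 1 s 1))
  have hcard : F.card ≤ S.card + 1 :=
    (Finset.card_insert_le _ _).trans (Nat.add_le_add_right Finset.card_image_le 1)
  refine (iInf₂_le F ?_).trans (by exact_mod_cast hcard)
  rintro _ ⟨t, rfl⟩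
  obtain ⟨s, hsS, hst, hd⟩ := hS t
  have hmem : W (lp.single 1 s 1) ∈ F :=
    Finset.mem_insert_of_mem (Finset.mem_image_of_mem (fun s => W (lp.single 1 s 1)) hsS)
  rcases hst.eq_or_lt with rfl | hlt
  · exact ⟨_, hmem, by simpa using hε⟩
  by_cases hσ : σ s = σ t
  · refine ⟨_, hmem, key t s _ hlt hd (fun r hr => ?_) fun r hr => ?_⟩
    · have hrσ : σ r = σ t := le_antisymm ((hσmono hr.1.le).trans hσ.le) (hσmono hr.2)
      rw [lp.coeFn_sub, Pi.sub_apply, hW, hW, if_pos ⟨hr.2, hrσ⟩,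
        if_neg fun h => hr.1.not_ge h.1, sub_zero, abs_of_pos (mul_pos (hσpos t) (hα r))]
    · have hiff : r ≤ t ↔ r ≤ s := by
        refine ⟨fun hrt => ?_, fun hrs => hrs.trans hst⟩
        by_contra hrs
        have hsr : s ≤ r := (htree.2.1 t r s hrt hst).resolve_left hrs
        exact hr ⟨lt_of_le_not_ge hsr hrs, hrt⟩
      rw [lp.coeFn_sub, Pi.sub_apply, hW, hW, hσ, hiff, sub_self]
  · refine ⟨0, Finset.mem_insert_self _ _, ?_⟩
    rw [sub_zero]
    refine key t s _ hlt hd (fun r hr => ?_) fun r hr => ?_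
    · have hpos : 0 < σ t * α r := mul_pos (hσpos t) (hα r)
      rw [hW]
      split_ifs
      · exact (abs_of_pos hpos).le
      · simpa using hpos.le
    · rw [hW, if_neg]
      rintro ⟨hrt, hrσ⟩
      rcases htree.2.1 t r s hrt hst with h | h
      · exact hσ (le_antisymm ((hσmono h).trans hrσ.le) (hσmono hst))
      · refine hr ⟨lt_of_le_of_ne h ?_, hrt⟩
        rintro rfl
        exact hσ hrσ
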